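/- arXiv:2504.06734 — 2 statements merged into one kernel-verified Lean document; each statement's English description precedes it below -/
import Mathlib

section
/- Let C be an [n,k,d]_q linear code with all-symbol (r,δ)-locality. Then d ≤ n - k + 1 - (⌈k/r⌉ - 1)(δ - 1). -/
open Finset

/-- The subcode of `C` consisting of the codewords that vanish on `T`. -/
def subcodeVanishingOn {F ι : Type*} [Field F] (C : Submodule F (ι → F)) (T : Finset ι) :
    Submodule F (ι → F) where
  carrier := {c | c ∈ C ∧ ∀ i ∈ T, c i = 0}
  zero_mem' := ⟨C.zero_mem, fun _ _ => rfl⟩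
  add_mem' := fun ha hb =>
    ⟨C.add_mem ha.1 hb.1, fun i hi => by simp [ha.2 i hi, hb.2 i hi]⟩
  smul_mem' := fun a _ hc => ⟨C.smul_mem a hc.1, fun i hi => by simp [hc.2 i hi]⟩

theorem mem_subcodeVanishingOn {F ι : Type*} [Field F] {C : Submodule F (ι → F)}
    {T : Finset ι} {c : ι → F} :
    c ∈ subcodeVanishingOn C T ↔ c ∈ C ∧ ∀ i ∈ T, c i = 0 := Iff.rfl

theorem subcodeVanishingOn_empty {F ι : Type*} [Field F] (C : Submodule F (ι → F)) :
    subcodeVanishingOn C ∅ = C := by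
  ext c; simp [mem_subcodeVanishingOn]

theorem finrank_subcodeVanishingOn_le {F ι : Type*} [Field F] [Fintype ι] [DecidableEq ι]
    (C : Submodule F (ι → F)) (T A : Finset ι) :
    Module.finrank F (subcodeVanishingOn C T) ≤
      Module.finrank F (subcodeVanishingOn C (T ∪ A)) + A.card := by
  let g := (LinearMap.funLeft F F (Subtype.val : A → ι)).domRestrict (subcodeVanishingOn C T)
  have hrank := LinearMap.finrank_range_add_finrank_ker g
  have hrange : Module.finrank F (LinearMap.range g) ≤ A.card := by
    simpa using Submodule.finrank_le (LinearMap.range g)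
  have hker : Module.finrank F (LinearMap.ker g) ≤
      Module.finrank F (subcodeVanishingOn C (T ∪ A)) := by
    rw [← Submodule.finrank_map_subtype_eq]
    apply Submodule.finrank_mono
    rintro _ ⟨⟨c, hc⟩, hg, rfl⟩
    refine ⟨hc.1, fun i hi => ?_⟩
    rcases Finset.mem_union.1 hi with hi | hi
    · exact hc.2 i hi
    · exact congrFun (LinearMap.mem_ker.1 hg) ⟨i, hi⟩
  omega

theorem exists_ne_zero_of_finrank_subcodeVanishingOn_pos {F ι : Type*} [Field F] [Fintype ι]
    {C : Submodule F (ι → F)} {T : Finset ι}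
    (h : 0 < Module.finrank F (subcodeVanishingOn C T)) :
    ∃ c ∈ C, (∀ i ∈ T, c i = 0) ∧ c ≠ 0 := by
  obtain ⟨c, hc, hne⟩ := Submodule.exists_mem_ne_zero_of_ne_bot
    (p := subcodeVanishingOn C T) (by rintro h0; rw [h0, finrank_bot] at h; exact h.ne rfl)
  exact ⟨c, hc.1, hc.2, hne⟩

/-- The Singleton bound for the subcode of words vanishing on `T`. -/
theorem add_card_add_finrank_subcodeVanishingOn_le {F ι : Type*} [Field F] [DecidableEq F]
    [Fintype ι] [DecidableEq ι] {C : Submodule F (ι → F)} {d : ℕ}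
    (hd : ∀ c ∈ C, c ≠ 0 → d ≤ (Finset.univ.filter fun i => c i ≠ 0).card) {T : Finset ι}
    (hT : 0 < Module.finrank F (subcodeVanishingOn C T)) :
    d + T.card + Module.finrank F (subcodeVanishingOn C T) ≤ Fintype.card ι + 1 := by
  have huniv : subcodeVanishingOn C (T ∪ Tᶜ) = ⊥ := by
    rw [Finset.union_compl, eq_bot_iff]
    exact fun c hc => funext fun i => hc.2 i (Finset.mem_univ i)
  have hle := finrank_subcodeVanishingOn_le C T Tᶜ
  rw [huniv, finrank_bot, zero_add] at hle
  obtain ⟨A, hA, hAcard⟩ := Finset.exists_subset_card_eq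
    (show Module.finrank F (subcodeVanishingOn C T) - 1 ≤ Tᶜ.card by omega)
  have hTA := finrank_subcodeVanishingOn_le C T A
  obtain ⟨c, hcC, hc, hne⟩ := exists_ne_zero_of_finrank_subcodeVanishingOn_pos
    (C := C) (T := T ∪ A) (by omega)
  have hdisj : Disjoint T A :=
    Finset.disjoint_left.2 fun i hi hiA => Finset.mem_compl.1 (hA hiA) hi
  have hweight : (Finset.univ.filter fun i => c i ≠ 0).card ≤ (T ∪ A)ᶜ.card :=
    Finset.card_le_card fun i hi =>
      Finset.mem_compl.2 fun hiT => (Finset.mem_filter.1 hi).2 (hc i hiT)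
  have hcompl := Finset.card_add_card_compl (T ∪ A)
  have hunion := Finset.card_union_of_disjoint hdisj
  have := hd c hcC hne
  omega

/-- If some codeword vanishing on `T` does not vanish on the repair set `S`, then adjoining `S`
to `T` lowers the dimension by at most `|S \ T| - (δ - 1)`. -/
theorem finrank_subcodeVanishingOn_union_repair {F ι : Type*} [Field F] [DecidableEq F]
    [Fintype ι] [DecidableEq ι] {C : Submodule F (ι → F)} {δ : ℕ} {S T : Finset ι}
    (hδ : 1 ≤ δ)
    (hS : ∀ c ∈ C, (∃ j ∈ S, c j ≠ 0) → δ ≤ (S.filter fun j => c j ≠ 0).card)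
    {c : ι → F} (hcC : c ∈ C) (hcT : ∀ i ∈ T, c i = 0) (hcS : ∃ j ∈ S, c j ≠ 0) :
    Module.finrank F (subcodeVanishingOn C T) + (δ - 1) ≤
      Module.finrank F (subcodeVanishingOn C (T ∪ S)) + (S \ T).card := by
  have hcard : δ ≤ (S \ T).card := by
    refine (hS c hcC hcS).trans (Finset.card_le_card fun j hj => ?_)
    obtain ⟨hjS, hj⟩ := Finset.mem_filter.1 hj
    exact Finset.mem_sdiff.2 ⟨hjS, fun hjT => hj (hcT j hjT)⟩
  obtain ⟨B, hB, hBcard⟩ := Finset.exists_subset_card_eq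
    (show δ - 1 ≤ (S \ T).card by omega)
  have hle := finrank_subcodeVanishingOn_le C T ((S \ T) \ B)
  have hmono : Module.finrank F (subcodeVanishingOn C (T ∪ ((S \ T) \ B))) ≤
      Module.finrank F (subcodeVanishingOn C (T ∪ S)) := by
    refine Submodule.finrank_mono fun x hx => ⟨hx.1, ?_⟩
    have hxS : ∀ j ∈ S, x j = 0 := by
      by_contra! h
      have hsub : (S.filter fun j => x j ≠ 0) ⊆ B := by
        intro j hj
        obtain ⟨hjS, hj⟩ := Finset.mem_filter.1 hj
        by_contra hjB
        refine hj (hx.2 j ?_)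
        by_cases hjT : j ∈ T <;> simp [hjS, hjB, hjT]
      have := hS x hx.1 h
      have := Finset.card_le_card hsub
      omega
    intro j hj
    rcases Finset.mem_union.1 hj with hj | hj
    · exact hx.2 j (Finset.mem_union_left _ hj)
    · exact hxS j hj
  have := Finset.card_sdiff_add_card_eq_card hB
  omega

/-- A union of `m` repair sets, chosen greedily, has rank at most `m * r` and nullity at least
`m * (δ - 1)`. -/
theorem exists_finset_finrank_subcodeVanishingOn {F ι : Type*} [Field F] [DecidableEq F]
    [Fintype ι] [DecidableEq ι] {C : Submodule F (ι → F)} {r δ : ℕ} (hδ : 1 ≤ δ)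
    (hloc : ∀ i : ι, ∃ S : Finset ι, i ∈ S ∧ S.card ≤ r + δ - 1 ∧
      ∀ c ∈ C, (∃ j ∈ S, c j ≠ 0) → δ ≤ (S.filter fun j => c j ≠ 0).card)
    (m : ℕ) (hm : m * r < Module.finrank F C) :
    ∃ T : Finset ι,
      Module.finrank F C ≤ Module.finrank F (subcodeVanishingOn C T) + m * r ∧
      Module.finrank F C + m * (δ - 1) ≤
        Module.finrank F (subcodeVanishingOn C T) + T.card := by
  induction m with
  | zero => exact ⟨∅, by rw [subcodeVanishingOn_empty]; simp⟩
  | succ m ih =>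
    rw [add_one_mul] at hm
    obtain ⟨T, hrank, hnull⟩ := ih (by omega)
    obtain ⟨c, hcC, hcT, hne⟩ := exists_ne_zero_of_finrank_subcodeVanishingOn_pos
      (C := C) (T := T) (by omega)
    obtain ⟨i, hi⟩ := Function.ne_iff.1 hne
    obtain ⟨S, hiS, hScard, hS⟩ := hloc i
    have hstep := finrank_subcodeVanishingOn_union_repair hδ hS hcC hcT ⟨i, hiS, hi⟩
    have hsdiff : (S \ T).card ≤ S.card := Finset.card_le_card Finset.sdiff_subset
    have hunion : (T ∪ S).card = T.card + (S \ T).card := by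
      rw [← Finset.union_sdiff_self_eq_union, Finset.card_union_of_disjoint Finset.disjoint_sdiff]
    refine ⟨T ∪ S, ?_, ?_⟩ <;> rw [add_one_mul] <;> omega

/-- Singleton-type bound for `[n,k,d]_q` linear codes with all-symbol
`(r,δ)`-locality: `d ≤ n - k + 1 - (⌈k/r⌉ - 1)(δ - 1)`. -/
theorem stmt_1 {F : Type*} [Field F] [Fintype F] [DecidableEq F] {n k d r δ : ℕ}
    (hr : 1 ≤ r) (hδ : 2 ≤ δ) (hk : 1 ≤ k)
    (C : Submodule F (Fin n → F))
    (hdim : Module.finrank F C = k)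
    (hlow : ∀ c ∈ C, c ≠ 0 → d ≤ (Finset.univ.filter fun i => c i ≠ 0).card)
    (hex : ∃ c ∈ C, c ≠ 0 ∧ (Finset.univ.filter fun i => c i ≠ 0).card = d)
    (hloc : ∀ i : Fin n, ∃ S : Finset (Fin n), i ∈ S ∧ S.card ≤ r + δ - 1 ∧
      ∀ c ∈ C, (∃ j ∈ S, c j ≠ 0) → δ ≤ (S.filter fun j => c j ≠ 0).card) :
    (d : ℤ) ≤ (n : ℤ) - k + 1 - (⌈(k : ℚ) / (r : ℚ)⌉ - 1) * ((δ : ℤ) - 1) := by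
  have hr0 : (0 : ℚ) < r := by exact_mod_cast hr
  have hk0 : (0 : ℚ) < k := by exact_mod_cast hk
  have hceil : 0 < ⌈(k : ℚ) / (r : ℚ)⌉ := Int.ceil_pos.2 (div_pos hk0 hr0)
  obtain ⟨m, hm⟩ := Int.eq_ofNat_of_zero_le (show 0 ≤ ⌈(k : ℚ) / (r : ℚ)⌉ - 1 by omega)
  have hmr : m * r < k := by
    have hlt : (m : ℤ) < ⌈(k : ℚ) / (r : ℚ)⌉ := by omega
    rw [Int.lt_ceil, lt_div_iff₀ hr0] at hlt
    exact_mod_cast hlt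
  obtain ⟨T, hrank, hnull⟩ :=
    exists_finset_finrank_subcodeVanishingOn (by omega) hloc m (by rwa [hdim])
  rw [hdim] at hrank hnull
  have hbound := add_card_add_finrank_subcodeVanishingOn_le hlow (T := T) (by omega)
  rw [Fintype.card_fin] at hbound
  have hfinal : d + k + m * (δ - 1) ≤ n + 1 := by omega
  rw [hm]
  zify [show 1 ≤ δ by omega] at hfinal
  linarith
end

section
/- Let C be a linear [n,k,d]_q code with all-symbol (r,δ)-locality and suppose r = d - δ and (r+δ-1) | n. Then the minimum distance satisfies the improved bound d ≤ n - k + 1 - ⌈k/r⌉(δ-1). -/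
open Finset

/-- The subcode of `C` consisting of the codewords that vanish on `T`. -/
def vanishingSubcode {F ι : Type*} [Field F] (C : Submodule F (ι → F)) (T : Finset ι) :
    Submodule F (ι → F) where
  carrier := {c | c ∈ C ∧ ∀ i ∈ T, c i = 0}
  add_mem' := fun ha hb =>
    ⟨C.add_mem ha.1 hb.1, fun i hi => by simp [ha.2 i hi, hb.2 i hi]⟩
  zero_mem' := ⟨C.zero_mem, fun _ _ => rfl⟩
  smul_mem' := fun a _ hc => ⟨C.smul_mem a hc.1, fun i hi => by simp [hc.2 i hi]⟩

section

variable {F ι : Type*} [Field F] {C : Submodule F (ι → F)}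

theorem mem_vanishingSubcode {T : Finset ι} {c : ι → F} :
    c ∈ vanishingSubcode C T ↔ c ∈ C ∧ ∀ i ∈ T, c i = 0 := Iff.rfl

theorem vanishingSubcode_empty : vanishingSubcode C ∅ = C := by
  ext c
  simp [mem_vanishingSubcode]

theorem exists_ne_zero_of_finrank_vanishingSubcode_pos {T : Finset ι}
    (h : 0 < Module.finrank F (vanishingSubcode C T)) :
    ∃ c ∈ C, c ≠ 0 ∧ ∀ i ∈ T, c i = 0 := by
  have hne : vanishingSubcode C T ≠ ⊥ := by
    intro hbot
    rw [hbot, finrank_bot] at h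
    exact lt_irrefl 0 h
  obtain ⟨c, hc, hc0⟩ := Submodule.exists_mem_ne_zero_of_ne_bot hne
  exact ⟨c, hc.1, hc0, hc.2⟩

variable [Fintype ι]

theorem finrank_vanishingSubcode_le_union [DecidableEq ι] (T A : Finset ι) :
    Module.finrank F (vanishingSubcode C T) ≤
      Module.finrank F (vanishingSubcode C (T ∪ A)) + A.card := by
  let f : vanishingSubcode C T →ₗ[F] (A → F) :=
    (LinearMap.funLeft F F (Subtype.val : A → ι)).comp (vanishingSubcode C T).subtype
  have hrange : Module.finrank F (LinearMap.range f) ≤ A.card := by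
    simpa using Submodule.finrank_le (LinearMap.range f)
  have hker : Module.finrank F (LinearMap.ker f) ≤
      Module.finrank F (vanishingSubcode C (T ∪ A)) := by
    rw [← Submodule.finrank_map_subtype_eq]
    apply Submodule.finrank_mono
    rintro _ ⟨c, hc, rfl⟩
    refine ⟨c.2.1, fun i hi => ?_⟩
    rcases Finset.mem_union.1 hi with h | h
    · exact c.2.2 i h
    · exact congrFun (LinearMap.mem_ker.1 hc) ⟨i, h⟩
  have := f.finrank_range_add_finrank_ker
  omega

/-- The Singleton bound for the subcode vanishing on `U`. -/
theorem card_add_finrank_vanishingSubcode_add_le [DecidableEq F] {d : ℕ}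
    (hlow : ∀ c ∈ C, c ≠ 0 → d ≤ (Finset.univ.filter fun i => c i ≠ 0).card) {U : Finset ι}
    (hU : 0 < Module.finrank F (vanishingSubcode C U)) :
    U.card + Module.finrank F (vanishingSubcode C U) + d ≤ Fintype.card ι + 1 := by
  classical
  have huniv : Module.finrank F (vanishingSubcode C (Finset.univ : Finset ι)) = 0 := by
    by_contra h
    obtain ⟨c, -, hc0, hc⟩ :=
      exists_ne_zero_of_finrank_vanishingSubcode_pos (Nat.pos_of_ne_zero h)
    exact hc0 (funext fun i => hc i (Finset.mem_univ i))
  have hcompl := finrank_vanishingSubcode_le_union (C := C) U Uᶜ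
  rw [Finset.union_compl, huniv] at hcompl
  obtain ⟨B, hBU, hB⟩ := Finset.exists_subset_card_eq
    (show Module.finrank F (vanishingSubcode C U) - 1 ≤ Uᶜ.card by omega)
  have hstep := finrank_vanishingSubcode_le_union (C := C) U B
  obtain ⟨c, hcC, hc0, hc⟩ := exists_ne_zero_of_finrank_vanishingSubcode_pos
    (C := C) (T := U ∪ B) (by omega)
  have hsub : (Finset.univ.filter fun i => c i ≠ 0) ⊆ (U ∪ B)ᶜ := by
    intro i hi
    rw [Finset.mem_compl]
    exact fun h => (Finset.mem_filter.1 hi).2 (hc i h)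
  have hle := (hlow c hcC hc0).trans (Finset.card_le_card hsub)
  have hdisj : Disjoint U B := by
    rw [Finset.disjoint_left]
    exact fun i hi hiB => Finset.mem_compl.1 (hBU hiB) hi
  have hcard := Finset.card_add_card_compl (U ∪ B)
  rw [Finset.card_union_of_disjoint hdisj] at hcard
  omega

/-- Under `(r, δ)`-locality, a set of coordinates on which some nonzero codeword vanishes can be
enlarged by a repair set, raising its rank by at most `r` and its nullity by at least `δ - 1`. -/
theorem exists_enlargement_of_locality [DecidableEq F] [DecidableEq ι] {r δ : ℕ} (hδ : 1 ≤ δ)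
    (hloc : ∀ i : ι, ∃ S : Finset ι, i ∈ S ∧ S.card ≤ r + δ - 1 ∧
      ∀ c ∈ C, (∃ j ∈ S, c j ≠ 0) → δ ≤ (S.filter fun j => c j ≠ 0).card)
    {U : Finset ι} (hU : 0 < Module.finrank F (vanishingSubcode C U)) :
    ∃ V : Finset ι,
      Module.finrank F (vanishingSubcode C U) ≤ Module.finrank F (vanishingSubcode C V) + r ∧
      U.card + Module.finrank F (vanishingSubcode C U) + (δ - 1) ≤
        V.card + Module.finrank F (vanishingSubcode C V) := by
  obtain ⟨c, hcC, hc0, hc⟩ := exists_ne_zero_of_finrank_vanishingSubcode_pos hU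
  obtain ⟨i, hi⟩ := Function.ne_iff.1 hc0
  obtain ⟨S, hiS, hS, hSmin⟩ := hloc i
  have hsub : (S.filter fun j => c j ≠ 0) ⊆ S \ U := by
    intro j hj
    rw [Finset.mem_filter] at hj
    exact Finset.mem_sdiff.2 ⟨hj.1, fun h => hj.2 (hc j h)⟩
  have hδS := (hSmin c hcC ⟨i, hiS, hi⟩).trans (Finset.card_le_card hsub)
  obtain ⟨A, hA, hAcard⟩ := Finset.exists_subset_card_eq (show δ - 1 ≤ (S \ U).card by omega)
  have hmono : vanishingSubcode C (U ∪ ((S \ U) \ A)) ≤ vanishingSubcode C (U ∪ S) := by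
    rintro x ⟨hxC, hx⟩
    have hxS : ∀ j ∈ S, x j = 0 := by
      by_contra! hne
      have hfilter : (S.filter fun j => x j ≠ 0) ⊆ A := by
        intro j hj
        rw [Finset.mem_filter] at hj
        by_contra hjA
        refine hj.2 (hx j ?_)
        simp only [Finset.mem_union, Finset.mem_sdiff]
        tauto
      have := (hSmin x hxC hne).trans (Finset.card_le_card hfilter)
      omega
    refine ⟨hxC, fun j hj => ?_⟩
    rcases Finset.mem_union.1 hj with h | h
    · exact hx j (Finset.mem_union_left _ h)
    · exact hxS j h
  have hrank := finrank_vanishingSubcode_le_union (C := C) U ((S \ U) \ A)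
  have hfin := Submodule.finrank_mono hmono
  have hcard : ((S \ U) \ A).card = (S \ U).card - A.card := Finset.card_sdiff_of_subset hA
  have hle : (S \ U).card ≤ S.card := Finset.card_le_card Finset.sdiff_subset
  have hunion : (U ∪ S).card = U.card + (S \ U).card := by
    rw [← Finset.union_sdiff_self_eq_union, Finset.card_union_of_disjoint Finset.disjoint_sdiff]
  exact ⟨U ∪ S, by omega, by omega⟩

theorem exists_finset_finrank_of_locality [DecidableEq F] {r δ : ℕ} (hδ : 1 ≤ δ)
    (hloc : ∀ i : ι, ∃ S : Finset ι, i ∈ S ∧ S.card ≤ r + δ - 1 ∧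
      ∀ c ∈ C, (∃ j ∈ S, c j ≠ 0) → δ ≤ (S.filter fun j => c j ≠ 0).card)
    (s : ℕ) (hs : s * r < Module.finrank F C) :
    ∃ U : Finset ι,
      Module.finrank F C ≤ Module.finrank F (vanishingSubcode C U) + s * r ∧
      Module.finrank F C + s * (δ - 1) ≤
        U.card + Module.finrank F (vanishingSubcode C U) := by
  classical
  induction s with
  | zero => exact ⟨∅, by rw [vanishingSubcode_empty]; omega, by rw [vanishingSubcode_empty]; simp⟩
  | succ s ih =>
    rw [Nat.succ_mul] at hs
    obtain ⟨U, hU, hUcard⟩ := ih (by omega)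
    obtain ⟨V, hV, hVcard⟩ := exists_enlargement_of_locality hδ hloc (U := U) (by omega)
    refine ⟨V, ?_, ?_⟩ <;> rw [Nat.succ_mul] <;> omega

/-- The Singleton-type bound for codes with all-symbol `(r, δ)`-locality. -/
theorem singleton_bound_of_locality [DecidableEq F] {d r δ : ℕ} (hδ : 1 ≤ δ)
    (hlow : ∀ c ∈ C, c ≠ 0 → d ≤ (Finset.univ.filter fun i => c i ≠ 0).card)
    (hloc : ∀ i : ι, ∃ S : Finset ι, i ∈ S ∧ S.card ≤ r + δ - 1 ∧
      ∀ c ∈ C, (∃ j ∈ S, c j ≠ 0) → δ ≤ (S.filter fun j => c j ≠ 0).card)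
    (s : ℕ) (hs : s * r < Module.finrank F C) :
    d + Module.finrank F C + s * (δ - 1) ≤ Fintype.card ι + 1 := by
  obtain ⟨U, hU, hUcard⟩ := exists_finset_finrank_of_locality hδ hloc s hs
  have := card_add_finrank_vanishingSubcode_add_le hlow (U := U) (by omega)
  omega

end

/-- improved Singleton-type bound: if `r = d - δ` and `(r+δ-1) ∣ n`, then an
`[n,k,d]_q` code with all-symbol `(r,δ)`-locality satisfies `d ≤ n - k + 1 - ⌈k/r⌉(δ-1)`. -/
theorem stmt_12 {F : Type*} [Field F] [Fintype F] [DecidableEq F] {n k d r δ : ℕ}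
    (hr : 1 ≤ r) (hδ : 2 ≤ δ) (hk : 1 ≤ k)
    (hrd : r = d - δ) (hdδ : δ ≤ d) (hdvd : (r + δ - 1) ∣ n)
    (C : Submodule F (Fin n → F))
    (hdim : Module.finrank F C = k)
    (hlow : ∀ c ∈ C, c ≠ 0 → d ≤ (Finset.univ.filter fun i => c i ≠ 0).card)
    (hex : ∃ c ∈ C, c ≠ 0 ∧ (Finset.univ.filter fun i => c i ≠ 0).card = d)
    (hloc : ∀ i : Fin n, ∃ S : Finset (Fin n), i ∈ S ∧ S.card ≤ r + δ - 1 ∧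
      ∀ c ∈ C, (∃ j ∈ S, c j ≠ 0) → δ ≤ (S.filter fun j => c j ≠ 0).card) :
    (d : ℤ) ≤ (n : ℤ) - k + 1 - ⌈(k : ℚ) / (r : ℚ)⌉ * ((δ : ℤ) - 1) := by
  obtain ⟨s, hs1, hs2⟩ : ∃ s : ℕ, s * r < k ∧ k ≤ s * r + r := by
    refine ⟨(k - 1) / r, ?_, ?_⟩
    · have := Nat.div_mul_le_self (k - 1) r
      omega
    · have := Nat.lt_div_mul_add (a := k - 1) (show 0 < r by omega)
      omega
  have hceil : ⌈(k : ℚ) / (r : ℚ)⌉ = (s : ℤ) + 1 := by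
    have hr0 : (0 : ℚ) < r := by exact_mod_cast hr
    rw [Int.ceil_eq_iff]
    push_cast
    constructor
    · rw [add_sub_cancel_right, lt_div_iff₀ hr0]
      exact_mod_cast hs1
    · rw [div_le_iff₀ hr0, add_mul, one_mul]
      exact_mod_cast hs2
  have hbound := singleton_bound_of_locality (by omega) hlow hloc s (by omega)
  rw [hdim, Fintype.card_fin] at hbound
  obtain ⟨e, rfl⟩ : ∃ e, δ = e + 1 := ⟨δ - 1, by omega⟩
  obtain rfl : d = r + e + 1 := by omega
  obtain ⟨m, rfl⟩ := hdvd
  simp only [Nat.add_sub_cancel, ← add_assoc] at hbound ⊢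
  have hm : s + 2 ≤ m := by
    by_contra! hlt
    have := Nat.mul_le_mul_left (r + e) (show m ≤ s + 1 by omega)
    nlinarith
  have hn := Nat.mul_le_mul_left (r + e) hm
  rw [hceil]
  zify at hn hs2
  push_cast
  nlinarith
end
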